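/- arXiv:1404.7443 — 7 statements merged into one kernel-verified Lean document; each statement's English description precedes it below -/
import Mathlib

section
/- Let f be a Boolean function on n variables and i ∈ {1,…,n}. If there exist u, v ∈ {0,1}^n such that u_i = 0, v_i = 1, u_j = v_j for all j ≠ i, f(u) = 1 and f(v) = 0, then every orientation β of f satisfies β_i = 1. -/
/-- `β` is an orientation of the Boolean function `f` on `n` variables:
there is a monotone Boolean function `h : {0,1}^{2n} → {0,1}` (modeled as a
monotone function on the product, ordered coordinatewise) with
`f x = h (x, x ⊕ β)` for all `x`, where `⊕` is coordinatewise XOR. -/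
def IsOrientation {n : ℕ} (f : (Fin n → Bool) → Bool) (β : Fin n → Bool) : Prop :=
  ∃ h : (Fin n → Bool) × (Fin n → Bool) → Bool,
    Monotone h ∧ ∀ x : Fin n → Bool, f x = h (x, fun i => xor (x i) (β i))

/-- If there are `u, v` differing exactly at coordinate `i`, with `u i = 0`,
`v i = 1`, `f u = 1` and `f v = 0`, then every orientation `β` of `f` has
`β i = 1`. -/
theorem orientation_forced_one {n : ℕ} (f : (Fin n → Bool) → Bool) (i : Fin n)
    (u v : Fin n → Bool) (hui : u i = false) (hvi : v i = true)
    (huv : ∀ j : Fin n, j ≠ i → u j = v j)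
    (hfu : f u = true) (hfv : f v = false)
    (β : Fin n → Bool) (hβ : IsOrientation f β) : β i = true := by
  by_contra hi
  obtain ⟨h, hmono, hf⟩ := hβ
  have hle : u ≤ v := fun j => by
    by_cases hj : j = i
    · simp [hj, hui]
    · exact (huv j hj).le
  have hxor : (fun j => xor (u j) (β j)) ≤ fun j => xor (v j) (β j) := fun j => by
    by_cases hj : j = i
    · simp [hj, hui, hi]
    · simp [huv j hj]
  have key := hmono (Prod.mk_le_mk.2 ⟨hle, hxor⟩)
  rw [← hf, ← hf, hfu, hfv] at key
  exact absurd key (by decide)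
end

section
/- For any Boolean function f on n variables, define β* ∈ {0,1}^n by β*_i = 1 if and only if there exist u, v ∈ {0,1}^n with u_i = 0, v_i = 1, u_j = v_j for all j ≠ i, f(u) = 1 and f(v) = 0. Then β* is an orientation of f, and every orientation β' of f satisfies β* ≤ β' coordinatewise; in particular f has a unique minimal orientation, namely β*. -/
/-- If `f` stays true whenever a single coordinate outside `{i | β i = true}` is raised, then it
stays true whenever any set of such coordinates is raised. -/
theorem eq_true_of_le_of_forall_update {ι : Type*} [Fintype ι] [DecidableEq ι]
    {f : (ι → Bool) → Bool} {β : ι → Bool}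
    (hf : ∀ i u, β i = false → u i = false → f u = true → f (Function.update u i true) = true)
    {x z : ι → Bool} (hxz : x ≤ z) (hβ : ∀ i, β i = true → x i = z i) (hx : f x = true) :
    f z = true := by
  have key : ∀ s : Finset ι, f (s.piecewise z x) = true := by
    intro s
    induction s using Finset.induction_on with
    | empty => simpa using hx
    | insert a s ha ih =>
      rw [Finset.piecewise_insert]
      have hu : s.piecewise z x a = x a := Finset.piecewise_eq_of_notMem s z x ha
      by_cases h : x a = z a
      · rwa [← h, ← hu, Function.update_eq_self]
      · have hlt := lt_of_le_of_ne (hxz a) h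
        obtain ⟨hxa, hza⟩ := Bool.lt_iff.mp hlt
        rw [hza]
        exact hf a _ (Bool.eq_false_iff.mpr fun hb => h (hβ a hb)) (hu.trans hxa) ih
  simpa using key Finset.univ

/-- If `f` stays true whenever coordinates outside `{i | β i = true}` are raised, then `β` is an
orientation of `f`. -/
theorem isOrientation_of_forall_le {n : ℕ} {f : (Fin n → Bool) → Bool} {β : Fin n → Bool}
    (hf : ∀ x z, x ≤ z → (∀ i, β i = true → x i = z i) → f x = true → f z = true) :
    IsOrientation f β := by
  classical
  refine ⟨fun p => decide (∃ x, f x = true ∧ x ≤ p.1 ∧ (fun i => xor (x i) (β i)) ≤ p.2), ?_, ?_⟩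
  · intro p q hpq
    rw [Bool.le_iff_imp]
    simp only [decide_eq_true_eq]
    rintro ⟨x, hx, h₁, h₂⟩
    exact ⟨x, hx, h₁.trans hpq.1, h₂.trans hpq.2⟩
  · intro z
    rw [Bool.eq_iff_iff, decide_eq_true_eq]
    refine ⟨fun hz => ⟨z, hz, le_rfl, le_rfl⟩, ?_⟩
    rintro ⟨x, hx, h₁, h₂⟩
    refine hf x z h₁ (fun i hi => le_antisymm (h₁ i) ?_) hx
    have h : (!x i) ≤ !z i := by simpa only [hi, Bool.xor_true] using h₂ i
    exact compl_le_compl_iff_le.mp h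

/-- A Boolean function is monotone in every coordinate at which an orientation vanishes. -/
theorem IsOrientation.le_of_agree {n : ℕ} {f : (Fin n → Bool) → Bool} {β : Fin n → Bool}
    (h : IsOrientation f β) {i : Fin n} (hi : β i = false) {u v : Fin n → Bool}
    (hle : u i ≤ v i) (huv : ∀ j, j ≠ i → u j = v j) : f u ≤ f v := by
  obtain ⟨g, hg, hfg⟩ := h
  rw [hfg u, hfg v]
  refine hg ⟨fun j => ?_, fun j => ?_⟩ <;> by_cases hj : j = i
  · exact hj ▸ hle
  · exact (huv j hj).le
  · subst hj
    simpa [hi] using hle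
  · simp [huv j hj]

/-- The canonical vector `βstar` (with a `1` exactly where a monotonicity
violation of `f` occurs in a single coordinate) is an orientation of `f`, and
is below every orientation of `f`: it is the unique minimal orientation. -/
theorem minimal_orientation {n : ℕ} (f : (Fin n → Bool) → Bool) (βstar : Fin n → Bool)
    (hchar : ∀ i : Fin n, βstar i = true ↔
      ∃ u v : Fin n → Bool, u i = false ∧ v i = true ∧
        (∀ j : Fin n, j ≠ i → u j = v j) ∧ f u = true ∧ f v = false) :
    IsOrientation f βstar ∧
      ∀ β' : Fin n → Bool, IsOrientation f β' → βstar ≤ β' := by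
  refine ⟨isOrientation_of_forall_le fun x z hxz hβ hx =>
    eq_true_of_le_of_forall_update (β := βstar) (fun i u hi hui hu => ?_) hxz hβ hx, ?_⟩
  · by_contra hv
    refine Bool.eq_false_iff.mp hi ((hchar i).mpr ⟨u, Function.update u i true, hui, by simp,
      fun j hj => (Function.update_of_ne hj _ _).symm, hu, Bool.eq_false_iff.mpr hv⟩)
  · intro β' h i
    rw [Bool.le_iff_imp]
    intro hi
    obtain ⟨u, v, hui, hvi, huv, hu, hv⟩ := (hchar i).mp hi
    by_contra hb
    have := h.le_of_agree (Bool.eq_false_iff.mpr hb) (by simp [hui]) huv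
    rw [hu, hv] at this
    exact absurd this (by decide)
end

section
/- Let f be a Boolean function on n variables and β ∈ {0,1}^n. Then β is an orientation of f if and only if for all u, v ∈ {0,1}^n with u ≤ v, f(u) = 1 and f(v) = 0, there exists an index i such that u_i = 0, v_i = 1 and β_i = 1. -/
/-- `β` is an orientation of `f` iff for all `u ≤ v` with `f u = 1` and
`f v = 0` there is an index `i` with `u i = 0`, `v i = 1` and `β i = 1`. -/
theorem isOrientation_iff {n : ℕ} (f : (Fin n → Bool) → Bool) (β : Fin n → Bool) :
    IsOrientation f β ↔
      ∀ u v : Fin n → Bool, u ≤ v → f u = true → f v = false →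
        ∃ i : Fin n, u i = false ∧ v i = true ∧ β i = true := by
  constructor
  · rintro ⟨h, hmono, hf⟩ u v huv hu hv
    by_contra! hne
    have hle : (u, fun i => xor (u i) (β i)) ≤ (v, fun i => xor (v i) (β i)) := by
      refine ⟨huv, fun i => ?_⟩
      have hi := huv i
      have hi' := hne i
      revert hi hi'
      dsimp only
      cases u i <;> cases v i <;> cases β i <;> simp [Bool.le_iff_imp]
    have hfuv := hmono hle
    rw [← hf, ← hf, hu, hv] at hfuv
    exact absurd hfuv (by decide)
  · intro H
    classical
    refine ⟨fun p => decide (∃ x, f x = true ∧ (x, fun i => xor (x i) (β i)) ≤ p), ?_, ?_⟩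
    · intro p q hpq
      refine Bool.le_iff_imp.mpr fun hp => ?_
      obtain ⟨x, hx, hxp⟩ := of_decide_eq_true hp
      exact decide_eq_true ⟨x, hx, hxp.trans hpq⟩
    · intro y
      rw [Bool.eq_iff_iff, decide_eq_true_iff]
      refine ⟨fun hy => ⟨y, hy, le_rfl⟩, ?_⟩
      rintro ⟨x, hx, hxy, hxor⟩
      by_contra hy
      obtain ⟨i, hxi, hyi, hβi⟩ := H x y hxy hx (Bool.eq_false_of_not_eq_true hy)
      have hi := hxor i
      simp [hxi, hyi, hβi, Bool.le_iff_imp] at hi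
end

section
/- Let ℓ be a Boolean function on n variables, let β be an orientation of ℓ and let γ be an orientation of its pointwise complement ¬ℓ. Then for all x, y ∈ {0,1}^n such that x_i = y_i for every index i with β_i = 1 or γ_i = 1, one has ℓ(x) = ℓ(y). -/
/-- A function with orientation `β` is monotone along increases that fix the support of `β`. -/
theorem IsOrientation.le_of_le {n : ℕ} {f : (Fin n → Bool) → Bool} {β : Fin n → Bool}
    (hf : IsOrientation f β) {x y : Fin n → Bool} (hle : x ≤ y)
    (hxy : ∀ i, β i = true → x i = y i) : f x ≤ f y := by
  obtain ⟨h, hmono, hfh⟩ := hf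
  rw [hfh x, hfh y]
  refine hmono (Prod.mk_le_mk.2 ⟨hle, fun i => ?_⟩)
  cases hβ : β i
  · simpa [hβ] using hle i
  · simp [hβ, hxy i hβ]

/-- If `f` and its complement have orientations `β` and `γ`, then `f` is constant along increases
that fix the supports of `β` and `γ`. -/
theorem IsOrientation.eq_of_le {n : ℕ} {f : (Fin n → Bool) → Bool} {β γ : Fin n → Bool}
    (hβ : IsOrientation f β) (hγ : IsOrientation (fun x => !(f x)) γ)
    {x y : Fin n → Bool} (hle : x ≤ y)
    (hxy : ∀ i, (β i = true ∨ γ i = true) → x i = y i) : f x = f y := by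
  have h₁ := hβ.le_of_le hle fun i hi => hxy i (Or.inl hi)
  have h₂ := hγ.le_of_le hle fun i hi => hxy i (Or.inr hi)
  revert h₁ h₂
  cases f x <;> cases f y <;> simp

/-- If `β` is an orientation of `ℓ` and `γ` is an orientation of its
complement, then `ℓ x = ℓ y` whenever `x` and `y` agree on all coordinates in
the union of the supports of `β` and `γ`. -/
theorem sensitive_only_on_supports {n : ℕ} (ℓ : (Fin n → Bool) → Bool)
    (β γ : Fin n → Bool)
    (hβ : IsOrientation ℓ β) (hγ : IsOrientation (fun x => !(ℓ x)) γ)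
    (x y : Fin n → Bool)
    (hxy : ∀ i : Fin n, (β i = true ∨ γ i = true) → x i = y i) :
    ℓ x = ℓ y := by
  have hx : ℓ (x ⊓ y) = ℓ x :=
    hβ.eq_of_le hγ inf_le_left fun i hi => by simp [hxy i hi]
  have hy : ℓ (x ⊓ y) = ℓ y :=
    hβ.eq_of_le hγ inf_le_right fun i hi => by simp [hxy i hi]
  exact hx.symm.trans hy
end

section
/- Let f be a Boolean function on n variables that is sensitive on every input, i.e., for every index i there exist x, y ∈ {0,1}^n differing only in coordinate i with f(x) ≠ f(y). If f has an orientation of weight at most w and its pointwise complement ¬f also has an orientation of weight at most w, then n ≤ 2w. -/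
/-- A function is monotone in every coordinate outside the support of an orientation. -/
lemma IsOrientation.apply_le {n : ℕ} {f : (Fin n → Bool) → Bool} {β : Fin n → Bool}
    (hβ : IsOrientation f β) {i : Fin n} (hi : β i = false) {x y : Fin n → Bool}
    (hxy : ∀ j : Fin n, j ≠ i → x j = y j) (hle : x i ≤ y i) : f x ≤ f y := by
  obtain ⟨h, hmono, hf⟩ := hβ
  rw [hf x, hf y]
  refine hmono ⟨fun j => ?_, fun j => ?_⟩
  all_goals
    rcases eq_or_ne j i with rfl | hj
    · simpa [hi] using hle
    · simp [hxy j hj]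

/-- The supports of orientations of `f` and of its complement together contain every
coordinate on which `f` is sensitive. -/
lemma IsOrientation.eq_true_or_eq_true {n : ℕ} {f : (Fin n → Bool) → Bool}
    {β γ : Fin n → Bool} (hβ : IsOrientation f β) (hγ : IsOrientation (fun x => !(f x)) γ)
    {i : Fin n} {x y : Fin n → Bool} (hxy : ∀ j : Fin n, j ≠ i → x j = y j)
    (hf : f x ≠ f y) : β i = true ∨ γ i = true := by
  by_contra! hne
  have hβi : β i = false := by simpa using hne.1
  have hγi : γ i = false := by simpa using hne.2
  have eq_of_le {u v : Fin n → Bool} (huv : ∀ j : Fin n, j ≠ i → u j = v j)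
      (hle : u i ≤ v i) : f u = f v := by
    have h₁ := hβ.apply_le hβi huv hle
    have h₂ := hγ.apply_le hγi huv hle
    revert h₁ h₂
    cases f u <;> cases f v <;> decide
  rcases le_total (x i) (y i) with hle | hle
  · exact hf (eq_of_le hxy hle)
  · exact hf (eq_of_le (fun j hj => (hxy j hj).symm) hle).symm

/-- If `f` is sensitive on every input coordinate, and both `f` and its
complement have orientations of weight at most `w`, then `n ≤ 2w`. -/
theorem sensitive_bound {n : ℕ} (f : (Fin n → Bool) → Bool)
    (hsens : ∀ i : Fin n, ∃ x y : Fin n → Bool,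
      (∀ j : Fin n, j ≠ i → x j = y j) ∧ x i ≠ y i ∧ f x ≠ f y)
    (w : ℕ) (β γ : Fin n → Bool)
    (hβ : IsOrientation f β)
    (hwβ : (Finset.univ.filter fun i : Fin n => β i = true).card ≤ w)
    (hγ : IsOrientation (fun x => !(f x)) γ)
    (hwγ : (Finset.univ.filter fun i : Fin n => γ i = true).card ≤ w) :
    n ≤ 2 * w := by
  have hcover : (Finset.univ : Finset (Fin n)) ⊆
      (Finset.univ.filter fun i : Fin n => β i = true) ∪
        (Finset.univ.filter fun i : Fin n => γ i = true) := by
    intro i _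
    obtain ⟨x, y, hxy, -, hf⟩ := hsens i
    simpa using hβ.eq_true_or_eq_true hγ hxy hf
  have hcard := (Finset.card_le_card hcover).trans (Finset.card_union_le _ _)
  rw [Finset.card_univ, Fintype.card_fin] at hcard
  omega
end

section
/- Let f₁, f₂ be Boolean functions on n variables with orientations β₁ and β₂ respectively. Then the coordinatewise OR β₁ ∨ β₂ is an orientation of the pointwise conjunction f₁ ∧ f₂ and also an orientation of the pointwise disjunction f₁ ∨ f₂. -/
/-- Any vector above an orientation is an orientation: where `β` vanishes, the second argument
`x i ⊕ β i` equals `x i` and can be read off the first one. -/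
theorem IsOrientation.of_le {n : ℕ} {f : (Fin n → Bool) → Bool} {β γ : Fin n → Bool}
    (hf : IsOrientation f β) (hβγ : β ≤ γ) : IsOrientation f γ := by
  obtain ⟨h, hh, hfh⟩ := hf
  refine ⟨fun p => h (p.1, fun i => if β i then p.2 i else p.1 i), fun p q hpq => hh ⟨hpq.1, ?_⟩,
    fun x => ?_⟩
  · intro i
    dsimp only
    split_ifs
    exacts [hpq.2 i, hpq.1 i]
  · rw [hfh]
    congr 2
    funext i
    have hi : β i ≤ γ i := hβγ i
    dsimp only
    revert hi
    generalize β i = b, γ i = c, x i = a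
    revert a b c
    decide

/-- A monotone binary operation applied pointwise preserves a common orientation. -/
theorem IsOrientation.map₂ {n : ℕ} {f₁ f₂ : (Fin n → Bool) → Bool} {β : Fin n → Bool}
    {op : Bool → Bool → Bool} (hop : ∀ ⦃a b c d⦄, a ≤ b → c ≤ d → op a c ≤ op b d)
    (h₁ : IsOrientation f₁ β) (h₂ : IsOrientation f₂ β) :
    IsOrientation (fun x => op (f₁ x) (f₂ x)) β := by
  obtain ⟨g₁, hg₁, hfg₁⟩ := h₁
  obtain ⟨g₂, hg₂, hfg₂⟩ := h₂
  exact ⟨fun p => op (g₁ p) (g₂ p), fun p q hpq => hop (hg₁ hpq) (hg₂ hpq),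
    fun x => by simp only [hfg₁, hfg₂]⟩

/-- If `β₁` is an orientation of `f₁` and `β₂` of `f₂`, then the
coordinatewise OR `β₁ ∨ β₂` is an orientation of both `f₁ ∧ f₂` and
`f₁ ∨ f₂`. -/
theorem orientation_and_or {n : ℕ} (f₁ f₂ : (Fin n → Bool) → Bool)
    (β₁ β₂ : Fin n → Bool)
    (h₁ : IsOrientation f₁ β₁) (h₂ : IsOrientation f₂ β₂) :
    IsOrientation (fun x => f₁ x && f₂ x) (fun i => β₁ i || β₂ i) ∧
    IsOrientation (fun x => f₁ x || f₂ x) (fun i => β₁ i || β₂ i) := by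
  have h₁' := h₁.of_le (γ := fun i => β₁ i || β₂ i) fun i => Bool.left_le_or _ _
  have h₂' := h₂.of_le (γ := fun i => β₁ i || β₂ i) fun i => Bool.right_le_or _ _
  exact ⟨h₁'.map₂ (op := and) (by decide) h₂', h₁'.map₂ (op := or) (by decide) h₂'⟩
end

section
/- Let n and u be even with u ≤ n − 2, let V be a vertex set of size n, let U ⊆ V with |U| = u, and let W ⊆ V \ U with |W| = n/2 − u/2. Let H be any simple graph on U, and let G be the simple graph on V whose edges are exactly: all pairs of distinct vertices within W, all pairs {a, b} with a ∈ U and b ∈ V \ U, and the edges of H (and no edges of G within V \ U leave W, and no other edges within U). Then G contains a clique of size n/2 if and only if H contains a clique of size u/2. -/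
/-- If every edge of `H` lies inside `U`, then a clique of `H` of size at most `U.card` can be
replaced by one of the same size contained in `U`. -/
theorem SimpleGraph.IsNClique.exists_subset_of_adj_mem {V : Type*} {H : SimpleGraph V}
    {U T : Finset V} {k : ℕ} (hH : ∀ a b : V, H.Adj a b → a ∈ U ∧ b ∈ U) (hk : k ≤ U.card)
    (hT : H.IsNClique k T) : ∃ T' ⊆ U, H.IsNClique k T' := by
  rcases Nat.lt_or_ge 1 k with h1 | h1
  · refine ⟨T, fun a ha => ?_, hT⟩
    obtain ⟨b, hb, hba⟩ := Finset.exists_mem_ne (hT.card_eq ▸ h1) a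
    exact (hH a b (hT.isClique ha hb hba.symm)).1
  · obtain ⟨T', hT'U, hT'⟩ := Finset.exists_subset_card_eq hk
    refine ⟨T', hT'U, ⟨fun a ha b hb hab => ?_, hT'⟩⟩
    exact absurd (Finset.card_le_one.1 (hT'.trans_le h1) a ha b hb) hab


/-- Restriction construction for CLIQUE(n, n/2): with `n, u` even, `u ≤ n - 2`,
`U` of size `u`, `W` disjoint from `U` of size `n/2 - u/2`, `H` a graph with
all its edges inside `U`, and `G` the graph whose edges are exactly all pairs
of distinct vertices within `W`, all pairs between `U` and its complement, and
the edges of `H`, the graph `G` has a clique of size `n/2` iff `H` has a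
clique of size `u/2`. -/
theorem clique_restriction {V : Type*} [Fintype V] [DecidableEq V]
    (n u : ℕ) (hn : Even n) (hu : Even u) (hun : u ≤ n - 2)
    (hcard : Fintype.card V = n)
    (U W : Finset V) (hUcard : U.card = u) (hWcard : W.card = n / 2 - u / 2)
    (hWU : Disjoint W U)
    (H G : SimpleGraph V)
    (hH : ∀ a b : V, H.Adj a b → a ∈ U ∧ b ∈ U)
    (hG : ∀ a b : V, G.Adj a b ↔ a ≠ b ∧
      ((a ∈ W ∧ b ∈ W) ∨ (a ∈ U ∧ b ∉ U) ∨ (b ∈ U ∧ a ∉ U) ∨ H.Adj a b)) :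
    (∃ S : Finset V, G.IsNClique (n / 2) S) ↔
      ∃ S : Finset V, H.IsNClique (u / 2) S := by
  have hle : u / 2 ≤ n / 2 := by omega
  constructor
  · rintro ⟨S, hS⟩
    have hout : (S \ U).card ≤ n / 2 - u / 2 := by
      rcases Nat.lt_or_ge 1 (S \ U).card with h1 | h1
      · rw [← hWcard]
        refine Finset.card_le_card fun a ha => ?_
        obtain ⟨b, hb, hba⟩ := Finset.exists_mem_ne h1 a
        rw [Finset.mem_sdiff] at ha hb
        have hab := (hG a b).1 (hS.isClique ha.1 hb.1 hba.symm)
        have hHab := hH a b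
        tauto
      · have hSU := Finset.card_le_card (Finset.sdiff_subset : S \ U ⊆ S)
        have hScard := hS.card_eq
        obtain ⟨m, rfl⟩ := hn
        obtain ⟨v, rfl⟩ := hu
        omega
    have hsplit := Finset.card_sdiff_add_card_inter S U
    have hin : u / 2 ≤ (S ∩ U).card := by
      have hScard := hS.card_eq
      omega
    obtain ⟨T, hTS, hT⟩ := Finset.exists_subset_card_eq hin
    refine ⟨T, ⟨fun a ha b hb hab => ?_, hT⟩⟩
    have ha' := Finset.mem_inter.1 (hTS ha)
    have hb' := Finset.mem_inter.1 (hTS hb)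
    have hadj := (hG a b).1 (hS.isClique ha'.1 hb'.1 hab)
    have haW : a ∉ W := fun h => Finset.disjoint_left.1 hWU h ha'.2
    tauto
  · rintro ⟨S, hS⟩
    obtain ⟨T, hTU, hT⟩ := hS.exists_subset_of_adj_mem hH (by omega)
    refine ⟨T ∪ W, ⟨fun a ha b hb hab => (hG a b).2 ⟨hab, ?_⟩, ?_⟩⟩
    · have hTadj : a ∈ T → b ∈ T → H.Adj a b := fun ha hb => hT.isClique ha hb hab
      have haU := @hTU a
      have hbU := @hTU b
      have haW : a ∈ W → a ∉ U := fun h => Finset.disjoint_left.1 hWU h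
      have hbW : b ∈ W → b ∉ U := fun h => Finset.disjoint_left.1 hWU h
      rw [Finset.mem_coe, Finset.mem_union] at ha hb
      tauto
    · rw [Finset.card_union_of_disjoint (hWU.symm.mono_left hTU), hT.card_eq, hWcard]
      omega
end
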